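/- Let C be a dualising k-variety and α : X → Y a morphism in C. Then in mod C there exists an injective envelope of the form Coker Hom_C(−, α) → D Hom_C(C, −) for some object C of C, and this C satisfies: α is right determined by C; moreover, for any object C' of C, the morphism α is right determined by C' if and only if add C ⊆ add C'. -/

import Mathlib

open CategoryTheory CategoryTheory.Limits Opposite

universe v u

/-- `α'` factors through `α` (both morphisms ending at the same object). -/
def FactorsThru {C : Type*} [Category C] {X' X Y : C} (α' : X' ⟶ Y) (α : X ⟶ Y) : Prop :=
  ∃ φ : X' ⟶ X, φ ≫ α = α'

/-- A morphism `α : X ⟶ Y` is right determined by an object `c` if for every morphism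
`α' : X' ⟶ Y`, `α'` factors through `α` iff for every `φ : c ⟶ X'` the composite
`φ ≫ α'` factors through `α`. -/
def RightDetermined {C : Type*} [Category C] {X Y : C} (α : X ⟶ Y) (c : C) : Prop :=
  ∀ ⦃X' : C⦄ (α' : X' ⟶ Y),
    FactorsThru α' α ↔ ∀ φ : c ⟶ X', FactorsThru (φ ≫ α') α

/-- A morphism is left determined by `c` if it is right determined by `c` as a morphism
of the opposite category. -/
def LeftDetermined {C : Type*} [Category C] {X Y : C} (α : X ⟶ Y) (c : C) : Prop :=
  RightDetermined α.op (op c)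

/-- `α : X ⟶ Y` is right minimal if every `φ : X ⟶ X` with `φ ≫ α = α` is an isomorphism. -/
def RightMinimal {C : Type*} [Category C] {X Y : C} (α : X ⟶ Y) : Prop :=
  ∀ φ : X ⟶ X, φ ≫ α = α → IsIso φ

/-- The image of the induced map `Hom(c, X) → Hom(c, Y)`, as a subset of `Hom(c, Y)`. -/
def ImHom {C : Type*} [Category C] (c : C) {X Y : C} (α : X ⟶ Y) : Set (c ⟶ Y) :=
  {g : c ⟶ Y | ∃ f : c ⟶ X, f ≫ α = g}
/-- `E` is an injective envelope of `k/𝔯` over `k`, where `𝔯` is the Jacobson radical of `k`: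
`E` is an injective `k`-module and there is an injective `k`-linear map
`k/𝔯 →ₗ[k] E` whose image is an essential submodule of `E`. -/
def IsInjectiveEnvelopeOfResidueField (k : Type v) [CommRing k]
    (E : Type v) [AddCommGroup E] [Module k E] : Prop :=
  Module.Injective k E ∧
    ∃ i : (k ⧸ (⊥ : Ideal k).jacobson) →ₗ[k] E,
      Function.Injective i ∧
      ∀ N : Submodule k E, N ≠ ⊥ → N ⊓ LinearMap.range i ≠ ⊥
section ModCat

variable (k : Type v) [CommRing k] (E : Type v) [AddCommGroup E] [Module k E]
variable (C : Type u) [Category.{v} C] [Preadditive C] [Linear k C]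

/-- A functor `F : Cᵒᵖ ⥤ ModuleCat k` is finitely presented if there is an exact sequence
`Hom_C(−, X) → Hom_C(−, Y) → F → 0`, i.e. `F` is a cokernel of a morphism between
representable functors.  (`mod C` is the full subcategory of such functors.) -/
def IsFPContra (F : Cᵒᵖ ⥤ ModuleCat.{v} k) : Prop :=
  ∃ (X Y : C) (p : X ⟶ Y), Nonempty (F ≅ Limits.cokernel ((linearYoneda k C).map p))

/-- A functor `G : C ⥤ ModuleCat k` is finitely presented if there is an exact sequence
`Hom_C(Y, −) → Hom_C(X, −) → G → 0`, i.e. `G` is a cokernel of a morphism between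
corepresentable functors.  (`mod (Cᵒᵖ)` is the full subcategory of such functors.) -/
def IsFPCov (G : C ⥤ ModuleCat.{v} k) : Prop :=
  ∃ (X Y : C) (p : X ⟶ Y), Nonempty (G ≅ Limits.cokernel ((linearCoyoneda k C).map p.op))

/-- The duality `D = Hom_k(−, E) : (ModuleCat k)ᵒᵖ ⥤ ModuleCat k`. -/
noncomputable abbrev DModule : (ModuleCat.{v} k)ᵒᵖ ⥤ ModuleCat.{v} k :=
  (linearYoneda k (ModuleCat.{v} k)).obj (ModuleCat.of k E)

/-- The functor `F ↦ D ∘ F` from presheaves to copresheaves. -/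
noncomputable def dualizeContra :
    (Cᵒᵖ ⥤ ModuleCat.{v} k)ᵒᵖ ⥤ (C ⥤ ModuleCat.{v} k) :=
  Functor.opHom Cᵒᵖ (ModuleCat.{v} k) ⋙
    (Functor.whiskeringLeft C Cᵒᵖᵒᵖ (ModuleCat.{v} k)ᵒᵖ).obj (opOp C) ⋙
    (Functor.whiskeringRight C (ModuleCat.{v} k)ᵒᵖ (ModuleCat.{v} k)).obj (DModule k E)

/-- The functor `G ↦ D ∘ G` from copresheaves to presheaves. -/
noncomputable def dualizeCov :
    (C ⥤ ModuleCat.{v} k)ᵒᵖ ⥤ (Cᵒᵖ ⥤ ModuleCat.{v} k) :=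
  Functor.opHom C (ModuleCat.{v} k) ⋙
    (Functor.whiskeringRight Cᵒᵖ (ModuleCat.{v} k)ᵒᵖ (ModuleCat.{v} k)).obj (DModule k E)

/-- `C` is a dualising `k`-variety: `F ↦ D ∘ F` sends finitely presented presheaves to
finitely presented copresheaves and the induced functor `(mod C)ᵒᵖ ⥤ mod (Cᵒᵖ)` is an
equivalence of categories. -/
noncomputable def IsDualisingVariety : Prop :=
  ∃ h : ∀ F : ObjectProperty.FullSubcategory (IsFPContra k C),
      IsFPCov k C ((dualizeContra k E C).obj (op F.obj)),
    (ObjectProperty.lift (IsFPCov k C)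
      ((ObjectProperty.ι (IsFPContra k C)).op ⋙ dualizeContra k E C)
      (fun F => h F.unop)).IsEquivalence

end ModCat
/-- `x` lies in `add c`: it is a direct summand of a finite direct sum of copies of `c`. -/
def MemAdd {C : Type*} [Category C] [Preadditive C] [HasFiniteBiproducts C]
    (x c : C) : Prop :=
  ∃ (n : ℕ) (s : x ⟶ ⨁ fun _ : Fin n => c) (r : (⨁ fun _ : Fin n => c) ⟶ x), s ≫ r = 𝟙 x

section Cogenerator

variable {k : Type v} [CommRing k] [IsArtinianRing k]

/-- Over an artinian ring, every maximal ideal annihilates an element outside the Jacobson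
radical modulo the radical. -/
lemma exists_notMem_jacobson_mul_mem (m : Ideal k) [hm : m.IsMaximal] :
    ∃ a : k, a ∉ (⊥ : Ideal k).jacobson ∧ ∀ r ∈ m, r * a ∈ (⊥ : Ideal k).jacobson := by
  classical
  have := Fintype.ofFinite (MaximalSpectrum k)
  let s : Finset (MaximalSpectrum k) := Finset.univ.filter fun p => p.asIdeal ≠ m
  have hs : ¬ s.inf (fun p => p.asIdeal) ≤ m := by
    rw [hm.isPrime.inf_le']
    rintro ⟨p, hp, hpm⟩
    exact (Finset.mem_filter.1 hp).2 (p.isMaximal.eq_of_le hm.ne_top hpm)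
  obtain ⟨a, has, ham⟩ := SetLike.not_le_iff_exists.1 hs
  have has' : ∀ p : Ideal k, p.IsMaximal → p ≠ m → a ∈ p := fun p hp hpm =>
    (Finset.inf_le (f := fun p : MaximalSpectrum k => p.asIdeal)
      (Finset.mem_filter.2 ⟨Finset.mem_univ (⟨p, hp⟩ : MaximalSpectrum k), hpm⟩)) has
  refine ⟨a, fun h => ham ((Submodule.mem_sInf.1 h) m ⟨bot_le, hm⟩), fun r hr => ?_⟩
  refine Submodule.mem_sInf.2 fun p ⟨_, hp⟩ => ?_
  by_cases hpm : p = m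
  · exact hpm ▸ m.mul_mem_right a hr
  · exact Ideal.mul_mem_left p r (has' p hp hpm)

variable {E : Type v} [AddCommGroup E] [Module k E]

/-- The injective envelope of `k/𝔯` is a cogenerator. -/
lemma IsInjectiveEnvelopeOfResidueField.exists_linearMap_ne_zero
    (hE : IsInjectiveEnvelopeOfResidueField k E) {N : Type v} [AddCommGroup N] [Module k N]
    {x : N} (hx : x ≠ 0) : ∃ f : N →ₗ[k] E, f x ≠ 0 := by
  obtain ⟨hinj, i, hi, -⟩ := hE
  have hann : LinearMap.ker (LinearMap.toSpanSingleton k N x) ≠ ⊤ := fun h => hx <| by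
    simpa using (h ▸ Submodule.mem_top : (1 : k) ∈ LinearMap.ker (LinearMap.toSpanSingleton k N x))
  obtain ⟨m, hm, hle⟩ := Ideal.exists_le_maximal _ hann
  obtain ⟨a, ha, ham⟩ := exists_notMem_jacobson_mul_mem m
  let g : k →ₗ[k] E := LinearMap.toSpanSingleton k E (i (Submodule.Quotient.mk a))
  have hg : LinearMap.ker (LinearMap.toSpanSingleton k N x) ≤ LinearMap.ker g := by
    intro r hr
    have : (r • Submodule.Quotient.mk a : k ⧸ (⊥ : Ideal k).jacobson) = 0 := by
      rw [← Submodule.Quotient.mk_smul, Submodule.Quotient.mk_eq_zero]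
      exact ham r (hle hr)
    rw [LinearMap.mem_ker, LinearMap.toSpanSingleton_apply, ← map_smul, this, map_zero]
  obtain ⟨h, hh⟩ := hinj.out (Submodule.liftQ _ (LinearMap.toSpanSingleton k N x) le_rfl)
    (LinearMap.ker_eq_bot.1 (Submodule.ker_liftQ_eq_bot _ _ _ le_rfl)) (Submodule.liftQ _ g hg)
  refine ⟨h, fun h0 => ha ?_⟩
  have h1 := hh (Submodule.Quotient.mk 1)
  rw [Submodule.liftQ_apply, Submodule.liftQ_apply, LinearMap.toSpanSingleton_apply, one_smul, h0,
    LinearMap.toSpanSingleton_apply, one_smul] at h1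
  rw [← Submodule.Quotient.mk_eq_zero]
  exact hi (by rw [← h1, map_zero])

end Cogenerator

section Retract

variable {k : Type v} [CommRing k] {C : Type u} [Category.{v} C] [Preadditive C] [Linear k C]

/-- Fitting's lemma for an endomorphism of an object with endomorphism ring of finite length. -/
lemma exists_idempotent_of_isFiniteLength {c : C} (h : IsFiniteLength k (c ⟶ c)) (φ : End c) :
    ∃ (n : ℕ) (b d : c ⟶ c), b ≫ b = b ∧ (φ ^ n : End c) ≫ b = (φ ^ n : End c) ∧
      (φ ^ n : End c) ≫ d = b ∧ 0 < n := by
  obtain ⟨_, _⟩ := isFiniteLength_iff_isNoetherian_isArtinian.1 h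
  obtain ⟨n, hn, hn0⟩ := ((LinearMap.eventually_isCompl_ker_pow_range_pow
    (Linear.leftComp k c φ : Module.End k (c ⟶ c))).and (Filter.eventually_gt_atTop 0)).exists
  have hpow : ∀ (m : ℕ) (f : c ⟶ c),
      ((Linear.leftComp k c φ : Module.End k (c ⟶ c)) ^ m) f = (φ ^ m : End c) ≫ f := by
    intro m f
    induction m with
    | zero => exact (Category.id_comp f).symm
    | succ m ih =>
      rw [pow_succ', Module.End.mul_apply, ih, pow_succ]
      exact (Category.assoc _ _ _).symm
  obtain ⟨a, ha, b, ⟨d, hd⟩, hab⟩ := Submodule.mem_sup.1 (hn.sup_eq_top ▸ Submodule.mem_top :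
    𝟙 c ∈ LinearMap.ker _ ⊔ LinearMap.range _)
  rw [LinearMap.mem_ker, hpow] at ha
  rw [hpow] at hd
  have hb : a = 𝟙 c - b := eq_sub_of_add_eq hab
  have hba : a ≫ b = 0 := by
    have hdisj := (Submodule.disjoint_def.1 hn.disjoint) (a ≫ b)
    refine hdisj ?_ ⟨d - d ≫ b, ?_⟩
    · rw [LinearMap.mem_ker, hpow, ← Category.assoc, ha, zero_comp]
    · rw [hpow, Preadditive.comp_sub, ← Category.assoc, hd, hb, Preadditive.sub_comp,
        Category.id_comp]
  refine ⟨n, b, d, ?_, ?_, hd, hn0⟩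
  · rw [hb, Preadditive.sub_comp, Category.id_comp, sub_eq_zero] at hba
    exact hba.symm
  · rw [hb, Preadditive.comp_sub, Category.comp_id, sub_eq_zero] at ha
    exact ha.symm

/-- A proper retract of an object with endomorphism ring of finite length has an endomorphism
ring of strictly smaller length. -/
lemma length_end_lt_of_retract {c c₁ : C} (h : IsFiniteLength k (c ⟶ c)) (i : c₁ ⟶ c) (e : c ⟶ c₁)
    (hie : i ≫ e = 𝟙 c₁) (hei : e ≫ i ≠ 𝟙 c) :
    Module.length k (c₁ ⟶ c₁) < Module.length k (c ⟶ c) := by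
  obtain ⟨_, _⟩ := isFiniteLength_iff_isNoetherian_isArtinian.1 h
  let g : (c₁ ⟶ c₁) →ₗ[k] (c ⟶ c) := Linear.leftComp k c e ∘ₗ Linear.rightComp k c₁ i
  have hg : Function.Injective g := by
    refine Function.LeftInverse.injective (g := fun f => i ≫ f ≫ e) fun f => ?_
    simp [g, hie, reassoc_of% hie]
  rw [(LinearEquiv.ofInjective g hg).length_eq]
  refine Submodule.length_lt fun htop => hei ?_
  obtain ⟨f, hf⟩ := (htop ▸ Submodule.mem_top : 𝟙 c ∈ LinearMap.range g)
  have hf' : e ≫ f ≫ i = 𝟙 c := hf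
  calc e ≫ i = (e ≫ i) ≫ e ≫ f ≫ i := by rw [hf', Category.comp_id]
    _ = e ≫ f ≫ i := by simp [reassoc_of% hie]
    _ = 𝟙 c := hf'

end Retract

section Presheaves

lemma map_op_comp_apply {k : Type v} [CommRing k] {C : Type u} [Category.{v} C]
    (F : Cᵒᵖ ⥤ ModuleCat.{v} k) {A B D : C} (f : A ⟶ B) (g : B ⟶ D)
    (x : F.obj (op D)) :
    (F.map (f ≫ g).op).hom x = (F.map f.op).hom ((F.map g.op).hom x) := by
  rw [op_comp, F.map_comp]
  rfl

variable {k : Type v} [CommRing k] {C : Type u} [Category.{v} C] [Preadditive C] [Linear k C]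

/-- The presheaf `Coker Hom(-, α)`. -/
noncomputable abbrev cokerYoneda (k : Type v) [CommRing k] {C : Type u} [Category.{v} C]
    [Preadditive C] [Linear k C] {X Y : C} (α : X ⟶ Y) : Cᵒᵖ ⥤ ModuleCat.{v} k :=
  cokernel ((linearYoneda k C).map α)

/-- The projection `Hom(A, Y) → Coker Hom(A, α)`. -/
noncomputable def cokerYonedaMk (k : Type v) [CommRing k] {C : Type u} [Category.{v} C]
    [Preadditive C] [Linear k C] {X Y : C} (α : X ⟶ Y) (A : C) :
    (A ⟶ Y) →ₗ[k] (cokerYoneda k α).obj (op A) :=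
  ((cokernel.π ((linearYoneda k C).map α)).app (op A)).hom

lemma cokerYonedaMk_surjective {X Y : C} (α : X ⟶ Y) (A : C) :
    Function.Surjective (cokerYonedaMk k α A) :=
  (ModuleCat.epi_iff_surjective ((cokernel.π ((linearYoneda k C).map α)).app (op A))).1
    inferInstance

lemma cokerYonedaMk_eq_zero_iff {X Y : C} (α : X ⟶ Y) {A : C} (f : A ⟶ Y) :
    cokerYonedaMk k α A f = 0 ↔ FactorsThru f α := by
  have hex := (ShortComplex.exact_cokernel ((linearYoneda k C).map α)).map
    ((evaluation Cᵒᵖ (ModuleCat.{v} k)).obj (op A))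
  rw [ShortComplex.moduleCat_exact_iff] at hex
  constructor
  · intro h
    obtain ⟨g, hg⟩ := hex f h
    exact ⟨g, hg⟩
  · rintro ⟨g, rfl⟩
    exact congrArg (fun t => (t.app (op A)).hom g) (cokernel.condition ((linearYoneda k C).map α))

lemma map_cokerYonedaMk {X Y : C} (α : X ⟶ Y) {A B : C} (g : A ⟶ B) (f : B ⟶ Y) :
    ((cokerYoneda k α).map g.op).hom (cokerYonedaMk k α B f) = cokerYonedaMk k α A (g ≫ f) :=
  (congrArg (fun t => t.hom f) ((cokernel.π ((linearYoneda k C).map α)).naturality g.op)).symm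

/-- The presheaf `F` is `k`-linear on morphisms. -/
def IsLinearPresheaf (F : Cᵒᵖ ⥤ ModuleCat.{v} k) : Prop :=
  ∀ ⦃A B : C⦄ (r : k) (f g : A ⟶ B) (x : F.obj (op B)),
    (F.map (r • f + g).op).hom x = r • (F.map f.op).hom x + (F.map g.op).hom x

lemma isLinearPresheaf_cokerYoneda {X Y : C} (α : X ⟶ Y) :
    IsLinearPresheaf (cokerYoneda k α) := by
  intro A B r f g x
  obtain ⟨y, rfl⟩ := cokerYonedaMk_surjective α B x
  simp only [map_cokerYonedaMk, Preadditive.add_comp, Linear.smul_comp, map_add, map_smul]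

lemma IsLinearPresheaf.of_iso {F G : Cᵒᵖ ⥤ ModuleCat.{v} k} (e : F ≅ G)
    (hG : IsLinearPresheaf G) : IsLinearPresheaf F := by
  intro A B r f g x
  have hinv : ∀ h : A ⟶ B, (F.map h.op).hom x =
      (e.inv.app (op A)).hom ((G.map h.op).hom ((e.hom.app (op B)).hom x)) := fun h => by
    have : F.map h.op = e.hom.app (op B) ≫ G.map h.op ≫ e.inv.app (op A) := by simp
    rw [this]
    rfl
  simp only [hinv, hG r f g, map_add, map_smul]

lemma IsFPContra.isLinearPresheaf {F : Cᵒᵖ ⥤ ModuleCat.{v} k} (hF : IsFPContra k C F) :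
    IsLinearPresheaf F := by
  obtain ⟨X, Y, p, ⟨e⟩⟩ := hF
  exact (isLinearPresheaf_cokerYoneda p).of_iso e

lemma IsLinearPresheaf.map_add {F : Cᵒᵖ ⥤ ModuleCat.{v} k} (hF : IsLinearPresheaf F) {A B : C}
    (f g : A ⟶ B) (x : F.obj (op B)) :
    (F.map (f + g).op).hom x = (F.map f.op).hom x + (F.map g.op).hom x := by
  simpa using hF 1 f g x

lemma IsLinearPresheaf.map_smul {F : Cᵒᵖ ⥤ ModuleCat.{v} k} (hF : IsLinearPresheaf F) {A B : C}
    (r : k) (f : A ⟶ B) (x : F.obj (op B)) :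
    (F.map (r • f).op).hom x = r • (F.map f.op).hom x := by
  have h0 := hF.map_add (0 : A ⟶ B) 0 x
  rw [add_zero, left_eq_add] at h0
  rw [← add_zero (r • f), hF r f 0 x, h0, add_zero]

/-- The action `Hom(A, B) → F A` on a section of `F` over `B`. -/
def IsLinearPresheaf.act {F : Cᵒᵖ ⥤ ModuleCat.{v} k} (hF : IsLinearPresheaf F) (A : C) {B : C}
    (x : F.obj (op B)) : (A ⟶ B) →ₗ[k] F.obj (op A) where
  toFun f := (F.map f.op).hom x
  map_add' f g := hF.map_add f g x
  map_smul' r f := hF.map_smul r f x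

lemma isFPContra_linearYoneda_obj (c : C) : IsFPContra k C ((linearYoneda k C).obj c) := by
  have h0 : (linearYoneda k C).map (0 : c ⟶ c) = 0 := by
    ext A f
    exact comp_zero
  exact ⟨c, c, 0, ⟨cokernelZeroIsoTarget.symm ≪≫ cokernelIsoOfEq h0.symm⟩⟩

lemma IsFPContra.of_iso {F G : Cᵒᵖ ⥤ ModuleCat.{v} k} (e : F ≅ G) (hG : IsFPContra k C G) :
    IsFPContra k C F := by
  obtain ⟨X, Y, p, ⟨e'⟩⟩ := hG
  exact ⟨X, Y, p, ⟨e ≪≫ e'⟩⟩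

/-- The morphism `Hom(-, c) ⟶ F` attached to a section of `F` over `c`. -/
def ofLinearYoneda {F : Cᵒᵖ ⥤ ModuleCat.{v} k} (hF : IsLinearPresheaf F) {c : C}
    (x : F.obj (op c)) : (linearYoneda k C).obj c ⟶ F where
  app A := ModuleCat.ofHom (X := A.unop ⟶ c) (hF.act A.unop x)
  naturality A B f := by
    ext g
    exact map_op_comp_apply F f.unop g x

/-- Monomorphisms of finitely presented presheaves are injective on sections. -/
lemma injective_of_mono_fp {F G : ObjectProperty.FullSubcategory (IsFPContra k C)} (f : F ⟶ G)
    [Mono f] (A : C) : Function.Injective (f.hom.app (op A)).hom := by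
  refine (injective_iff_map_eq_zero _).2 fun x hx => ?_
  have hF := F.property.isLinearPresheaf
  let P : ObjectProperty.FullSubcategory (IsFPContra k C) := ⟨_, isFPContra_linearYoneda_obj A⟩
  let s (y : F.obj.obj (op A)) : P ⟶ F := ObjectProperty.homMk (ofLinearYoneda hF y)
  have hs : s x ≫ f = s 0 ≫ f := by
    ext B g
    have h1 : ∀ y : F.obj.obj (op A), ((s y ≫ f).hom.app B).hom g =
        (G.obj.map g.op).hom ((f.hom.app (op A)).hom y) := fun y =>
      congrArg (fun t => t.hom y) (f.hom.naturality g.op)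
    refine (h1 x).trans (Eq.trans ?_ (h1 0).symm)
    rw [hx, map_zero, map_zero, map_zero]
  have h2 := congrArg (fun t => (t.hom.app (op A)).hom (𝟙 A)) ((cancel_mono f).1 hs)
  have h3 : ∀ y : F.obj.obj (op A), ((s y).hom.app (op A)).hom (𝟙 A) = y := fun y =>
    congrArg (fun t => t.hom y) (F.obj.map_id (op A))
  exact (h3 x).symm.trans (h2.trans (h3 0))

lemma mono_fp_of_injective {F G : ObjectProperty.FullSubcategory (IsFPContra k C)} (f : F ⟶ G)
    (h : ∀ A : C, Function.Injective (f.hom.app (op A)).hom) : Mono f := by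
  have : ∀ A, Mono (f.hom.app A) := fun A => (ModuleCat.mono_iff_injective _).2 (h A.unop)
  have : Mono f.hom := NatTrans.mono_of_mono_app _
  exact (ObjectProperty.ι _).mono_of_mono_map this

end Presheaves

section Duality

variable {k : Type v} [CommRing k] {C : Type u} [Category.{v} C] [Preadditive C] [Linear k C]
variable {E : Type v} [AddCommGroup E] [Module k E]

/-- The presheaf `D Hom(c, -)`. -/
noncomputable abbrev dualCoyoneda (k : Type v) [CommRing k] (E : Type v) [AddCommGroup E]
    [Module k E] {C : Type u} [Category.{v} C] [Preadditive C] [Linear k C] (c : C) :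
    Cᵒᵖ ⥤ ModuleCat.{v} k :=
  (dualizeCov k E C).obj (op ((linearCoyoneda k C).obj (op c)))

/-- Sections of `D Hom(c, -)` over `A` are the linear forms on `Hom(c, A)`. -/
noncomputable def dualCoyonedaEquiv (c A : C) :
    (dualCoyoneda k E c).obj (op A) ≃ₗ[k] ((c ⟶ A) →ₗ[k] E) :=
  ModuleCat.homLinearEquiv (S := k) (M := ModuleCat.of k (c ⟶ A)) (N := ModuleCat.of k E)

lemma dualCoyonedaEquiv_map {c A B : C} (f : A ⟶ B) (x : (dualCoyoneda k E c).obj (op B))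
    (ψ : c ⟶ A) :
    dualCoyonedaEquiv c A (((dualCoyoneda k E c).map f.op).hom x) ψ =
      dualCoyonedaEquiv c B x (ψ ≫ f) :=
  rfl

/-- The morphism `F ⟶ D Hom(c, -)` attached to a linear form on `F c`. -/
noncomputable def toDualCoyoneda {F : Cᵒᵖ ⥤ ModuleCat.{v} k} (hF : IsLinearPresheaf F) {c : C}
    (ξ : F.obj (op c) →ₗ[k] E) : F ⟶ dualCoyoneda k E c where
  app A := ModuleCat.ofHom (X := F.obj A) (Y := (dualCoyoneda k E c).obj A)
    ((dualCoyonedaEquiv c A.unop).symm.toLinearMap ∘ₗ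
      { toFun := fun x => ξ ∘ₗ hF.act c x
        map_add' := fun x y => by
          ext ψ
          simp [IsLinearPresheaf.act]
        map_smul' := fun r x => by
          ext ψ
          simp [IsLinearPresheaf.act] })
  naturality A B f := by
    ext x
    refine (dualCoyonedaEquiv c B.unop).injective ?_
    ext ψ
    exact congrArg ξ (map_op_comp_apply F ψ f.unop x).symm

lemma toDualCoyoneda_app {F : Cᵒᵖ ⥤ ModuleCat.{v} k} (hF : IsLinearPresheaf F) {c A : C}
    (ξ : F.obj (op c) →ₗ[k] E) (x : F.obj (op A)) (ψ : c ⟶ A) :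
    dualCoyonedaEquiv c A (((toDualCoyoneda hF ξ).app (op A)).hom x) ψ =
      ξ ((F.map ψ.op).hom x) :=
  rfl

/-- The linear form on `F c` attached to a morphism `F ⟶ D Hom(c, -)`. -/
noncomputable def formOfHom {F : Cᵒᵖ ⥤ ModuleCat.{v} k} {c : C} (h : F ⟶ dualCoyoneda k E c) :
    F.obj (op c) →ₗ[k] E :=
  LinearMap.applyₗ (𝟙 c) ∘ₗ (dualCoyonedaEquiv c c).toLinearMap ∘ₗ (h.app (op c)).hom

lemma dualCoyonedaEquiv_app {F : Cᵒᵖ ⥤ ModuleCat.{v} k} {c A : C} (h : F ⟶ dualCoyoneda k E c)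
    (x : F.obj (op A)) (ψ : c ⟶ A) :
    dualCoyonedaEquiv c A ((h.app (op A)).hom x) ψ = formOfHom h ((F.map ψ.op).hom x) := by
  have h1 : (h.app (op c)).hom ((F.map ψ.op).hom x) =
      ((dualCoyoneda k E c).map ψ.op).hom ((h.app (op A)).hom x) :=
    congrArg (fun t => t.hom x) (h.naturality ψ.op)
  change _ = dualCoyonedaEquiv c c ((h.app (op c)).hom ((F.map ψ.op).hom x)) (𝟙 c)
  rw [h1, dualCoyonedaEquiv_map, Category.id_comp]

/-- `D Hom(c, -)` is injective among the finitely presented presheaves. -/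
lemma injective_dualCoyoneda (hE : Module.Injective k E) {c : C}
    (hc : IsFPContra k C (dualCoyoneda k E c)) :
    Injective (⟨dualCoyoneda k E c, hc⟩ : ObjectProperty.FullSubcategory (IsFPContra k C)) where
  factors {F G} g f _ := by
    obtain ⟨ξ, hξ⟩ := hE.out (f.hom.app (op c)).hom (injective_of_mono_fp f c) (formOfHom g.hom)
    refine ⟨ObjectProperty.homMk (toDualCoyoneda G.property.isLinearPresheaf ξ), ?_⟩
    ext A x
    refine (dualCoyonedaEquiv c A.unop).injective ?_
    ext ψ
    have hnat : (G.obj.map ψ.op).hom ((f.hom.app A).hom x) =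
        (f.hom.app (op c)).hom ((F.obj.map ψ.op).hom x) :=
      (congrArg (fun t => t.hom x) (f.hom.naturality ψ.op)).symm
    refine Eq.trans ?_ (dualCoyonedaEquiv_app g.hom x ψ).symm
    rw [← hξ, ← hnat]
    rfl

/-- The morphism `D F ⟶ D Hom(-, x)` attached to a linear form on `D F x`. -/
noncomputable def dualToDualYoneda {F : Cᵒᵖ ⥤ ModuleCat.{v} k} (hF : IsLinearPresheaf F) {x : C}
    (θ : (F.obj (op x) →ₗ[k] E) →ₗ[k] E) :
    (dualizeContra k E C).obj (op F) ⟶ (dualizeContra k E C).obj (op ((linearYoneda k C).obj x))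
    where
  app A := ModuleCat.ofHom (X := F.obj (op A) ⟶ ModuleCat.of k E)
    (Y := ModuleCat.of k (A ⟶ x) ⟶ ModuleCat.of k E)
    { toFun := fun η => ModuleCat.ofHom
        { toFun := fun f => θ (η.hom ∘ₗ (F.map f.op).hom)
          map_add' := fun f g => by
            rw [← map_add]
            congr 1
            ext y
            exact (congrArg η.hom (hF.map_add f g y)).trans (map_add η.hom _ _)
          map_smul' := fun r f => by
            rw [RingHom.id_apply, ← map_smul]
            congr 1
            ext y
            exact (congrArg η.hom (hF.map_smul r f y)).trans (map_smul η.hom _ _) }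
      map_add' := fun η η' => by
        ext f
        exact (congrArg θ (LinearMap.add_comp _ _ _)).trans (map_add θ _ _)
      map_smul' := fun r η => by
        ext f
        exact (congrArg θ (LinearMap.smul_comp _ _ _)).trans (map_smul θ _ _) }
  naturality A B f := by
    ext η
    refine ModuleCat.hom_ext (LinearMap.ext fun g => congrArg θ ?_)
    refine LinearMap.ext fun y => congrArg (ModuleCat.Hom.hom η) ?_
    exact (map_op_comp_apply F f g y).symm

/-- In a dualising variety, sections of finitely presented presheaves are reflexive. -/
lemma IsDualisingVariety.exists_eval_eq (hdv : IsDualisingVariety k E C)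
    {F : Cᵒᵖ ⥤ ModuleCat.{v} k} (hF : IsFPContra k C F) {x : C}
    (θ : (F.obj (op x) →ₗ[k] E) →ₗ[k] E) : ∃ z : F.obj (op x), ∀ η, θ η = η z := by
  obtain ⟨h, heq⟩ := hdv
  let F' : ObjectProperty.FullSubcategory (IsFPContra k C) := ⟨F, hF⟩
  let P : ObjectProperty.FullSubcategory (IsFPContra k C) := ⟨_, isFPContra_linearYoneda_obj x⟩
  let Φ := ObjectProperty.lift (IsFPCov k C)
      ((ObjectProperty.ι (IsFPContra k C)).op ⋙ dualizeContra k E C) (fun F => h F.unop)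
  obtain ⟨m, hm⟩ := Φ.map_surjective (X := op F') (Y := op P)
    (ObjectProperty.homMk (dualToDualYoneda hF.isLinearPresheaf θ))
  refine ⟨(m.unop.hom.app (op x)).hom (𝟙 x), fun η => ?_⟩
  have h1 := congrArg (fun t => (ModuleCat.Hom.hom ((t.hom.app x).hom
    (ModuleCat.ofHom η : F.obj (op x) ⟶ ModuleCat.of k E))) (𝟙 x)) hm
  refine Eq.trans ?_ h1.symm
  refine congrArg θ (LinearMap.ext fun y => congrArg η ?_)
  exact (congrArg (fun t => t.hom y) (F.map_id (op x))).symm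

end Duality

section ThroughSpan

variable (k : Type*) [CommRing k] {C : Type*} [Category C] [Preadditive C]

/-- The morphisms `A ⟶ B` which are linear combinations of morphisms factoring through `c`. -/
def throughSpan [Linear k C] (c A B : C) : Submodule k (A ⟶ B) :=
  Submodule.span k {f | ∃ (s : A ⟶ c) (r : c ⟶ B), s ≫ r = f}

variable {k} [Linear k C]

lemma comp_mem_throughSpan (c A B : C) (s : A ⟶ c) (r : c ⟶ B) : s ≫ r ∈ throughSpan k c A B :=
  Submodule.subset_span ⟨s, r, rfl⟩

lemma comp_comp_mem_throughSpan {c A B A' B' : C} {t : A ⟶ B} (ht : t ∈ throughSpan k c A B)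
    (f : A' ⟶ A) (g : B ⟶ B') : f ≫ t ≫ g ∈ throughSpan k c A' B' := by
  have hle : throughSpan k c A B ≤
      (throughSpan k c A' B').comap (Linear.leftComp k B' f ∘ₗ Linear.rightComp k A g) := by
    refine Submodule.span_le.2 ?_
    rintro _ ⟨s, r, rfl⟩
    simpa using comp_mem_throughSpan (k := k) c A' B' (f ≫ s) (r ≫ g)
  exact hle ht

lemma memAdd_iff_id_mem_throughSpan [HasFiniteBiproducts C] {x c : C} :
    MemAdd x c ↔ 𝟙 x ∈ throughSpan k c x x := by
  constructor
  · rintro ⟨n, s, r, h⟩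
    have : 𝟙 x = ∑ i : Fin n, (s ≫ biproduct.π (fun _ : Fin n => c) i) ≫
        biproduct.ι (fun _ : Fin n => c) i ≫ r := by
      have htot := congrArg (fun t => s ≫ t ≫ r) (biproduct.total (f := fun _ : Fin n => c))
      simp only [Preadditive.sum_comp, Preadditive.comp_sum, Category.id_comp, h] at htot
      simp [← htot]
    rw [this]
    exact Submodule.sum_mem _ fun i _ => comp_mem_throughSpan _ _ _ _ _
  · intro h
    obtain ⟨n, a, g, hg⟩ := Submodule.mem_span_set'.1 h
    choose s r hsr using fun i => (g i).2
    refine ⟨n, biproduct.lift fun i => a i • s i, biproduct.desc r, ?_⟩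
    rw [biproduct.lift_desc, ← hg]
    simp [hsr]

end ThroughSpan

section RightDetermined

variable {C : Type*} [Category C] [Preadditive C]

lemma MemAdd.trans [HasFiniteBiproducts C] {x y z : C} (hxy : MemAdd x y) (hyz : MemAdd y z) :
    MemAdd x z := by
  rw [memAdd_iff_id_mem_throughSpan (k := ℤ)] at *
  refine (Submodule.span_le.2 ?_ : throughSpan ℤ y x x ≤ throughSpan ℤ z x x) hxy
  rintro _ ⟨s, r, rfl⟩
  simpa using comp_comp_mem_throughSpan hyz s r

lemma memAdd_self [HasFiniteBiproducts C] (c : C) : MemAdd c c := by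
  rw [memAdd_iff_id_mem_throughSpan (k := ℤ)]
  simpa using comp_mem_throughSpan (k := ℤ) c c c (𝟙 c) (𝟙 c)

lemma RightDetermined.of_memAdd [HasFiniteBiproducts C] {X Y : C} {α : X ⟶ Y} {c c' : C}
    (h : RightDetermined α c) (hc : MemAdd c c') : RightDetermined α c' := by
  rw [memAdd_iff_id_mem_throughSpan (k := ℤ)] at hc
  refine fun A f => ⟨fun ⟨g, hg⟩ φ => ⟨φ ≫ g, by rw [Category.assoc, hg]⟩, fun hf => ?_⟩
  refine (h f).2 fun φ => ?_
  have hle : throughSpan ℤ c' c A ≤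
      (LinearMap.range (Linear.rightComp ℤ c α)).comap (Linear.rightComp ℤ c f) := by
    refine Submodule.span_le.2 ?_
    rintro _ ⟨s, r, rfl⟩
    obtain ⟨g, hg⟩ := hf r
    exact ⟨s ≫ g, by simp [hg]⟩
  exact hle (by simpa using comp_comp_mem_throughSpan hc (𝟙 c) φ)

lemma rightDetermined_iff (k : Type v) [CommRing k] {C : Type u} [Category.{v} C] [Preadditive C]
    [Linear k C] {X Y : C} (α : X ⟶ Y) (c : C) :
    RightDetermined α c ↔ ∀ (A : C) (x : (cokerYoneda k α).obj (op A)),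
      (∀ φ : c ⟶ A, ((cokerYoneda k α).map φ.op).hom x = 0) → x = 0 := by
  constructor
  · intro h A x hx
    obtain ⟨f, rfl⟩ := cokerYonedaMk_surjective α A x
    simp only [map_cokerYonedaMk, cokerYonedaMk_eq_zero_iff] at hx ⊢
    exact (h f).2 hx
  · refine fun h A f => ⟨fun ⟨g, hg⟩ φ => ⟨φ ≫ g, by rw [Category.assoc, hg]⟩, fun hf => ?_⟩
    rw [← cokerYonedaMk_eq_zero_iff (k := k)]
    refine h A _ fun φ => ?_
    rw [map_cokerYonedaMk, cokerYonedaMk_eq_zero_iff]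
    exact hf φ

end RightDetermined

section Separating

variable {k : Type v} [CommRing k] {C : Type u} [Category.{v} C] [Preadditive C] [Linear k C]
variable {E : Type v} [AddCommGroup E] [Module k E]

/-- The linear form `ξ` on `F c` induces a pointwise injective morphism `F ⟶ D Hom(c, -)`. -/
def IsSeparating (F : Cᵒᵖ ⥤ ModuleCat.{v} k) {c : C} (ξ : F.obj (op c) →ₗ[k] E) : Prop :=
  ∀ (A : C) (x : F.obj (op A)), (∀ ψ : c ⟶ A, ξ ((F.map ψ.op).hom x) = 0) → x = 0

/-- Sections of `D F` over `A` are the linear forms on `F A`. -/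
noncomputable def dualizeContraEquiv (F : Cᵒᵖ ⥤ ModuleCat.{v} k) (A : C) :
    ((dualizeContra k E C).obj (op F)).obj A ≃ₗ[k] (F.obj (op A) →ₗ[k] E) :=
  ModuleCat.homLinearEquiv (S := k) (M := F.obj (op A)) (N := ModuleCat.of k E)

/-- The linear form on `F c` attached to a morphism `Hom(c, -) ⟶ D F`. -/
noncomputable def formOfCoyonedaHom {F : Cᵒᵖ ⥤ ModuleCat.{v} k} {c : C}
    (t : (linearCoyoneda k C).obj (op c) ⟶ (dualizeContra k E C).obj (op F)) :
    F.obj (op c) →ₗ[k] E :=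
  dualizeContraEquiv F c ((t.app c).hom (𝟙 c))

lemma dualizeContraEquiv_app {F : Cᵒᵖ ⥤ ModuleCat.{v} k} {c A : C}
    (t : (linearCoyoneda k C).obj (op c) ⟶ (dualizeContra k E C).obj (op F)) (ψ : c ⟶ A) :
    dualizeContraEquiv F A ((t.app A).hom ψ) = formOfCoyonedaHom t ∘ₗ (F.map ψ.op).hom := by
  have h : (t.app A).hom (𝟙 c ≫ ψ) =
      (((dualizeContra k E C).obj (op F)).map ψ).hom ((t.app c).hom (𝟙 c)) :=
    congrArg (fun s => s.hom (𝟙 c)) (t.naturality ψ)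
  rw [Category.id_comp] at h
  rw [h]
  rfl

lemma isFPCov_linearCoyoneda_obj (c : C) : IsFPCov k C ((linearCoyoneda k C).obj (op c)) := by
  have h0 : (linearCoyoneda k C).map (0 : c ⟶ c).op = 0 := by
    ext A f
    exact zero_comp
  exact ⟨c, c, 0, ⟨cokernelZeroIsoTarget.symm ≪≫ cokernelIsoOfEq h0.symm⟩⟩

lemma IsSeparating.exists_minimal [IsIdempotentComplete C]
    (homFinite : ∀ A B : C, IsFiniteLength k (A ⟶ B)) {F : Cᵒᵖ ⥤ ModuleCat.{v} k} {c₀ : C}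
    {ξ₀ : F.obj (op c₀) →ₗ[k] E} (h₀ : IsSeparating F ξ₀) :
    ∃ (c : C) (ξ : F.obj (op c) →ₗ[k] E), IsSeparating F ξ ∧
      ∀ φ : End c, ξ ∘ₗ (F.map (Quiver.Hom.op φ)).hom = ξ → ∃ d, φ ≫ d = 𝟙 c := by
  let S : Set ℕ∞ := {l | ∃ (c : C) (ξ : F.obj (op c) →ₗ[k] E),
    IsSeparating F ξ ∧ Module.length k (c ⟶ c) = l}
  obtain ⟨_, ⟨c, ξ, hξ, rfl⟩, hmin⟩ := wellFounded_lt.has_min S ⟨_, c₀, ξ₀, h₀, rfl⟩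
  refine ⟨c, ξ, hξ, fun φ hφ => ?_⟩
  obtain ⟨n, b, d, hb, hφb, hd, hn⟩ := exists_idempotent_of_isFiniteLength (homFinite c c) φ
  have hpow : ∀ (m : ℕ) (x : F.obj (op c)),
      ξ ((F.map (Quiver.Hom.op (φ ^ m : End c))).hom x) = ξ x := by
    intro m
    induction m with
    | zero => exact fun x => congrArg (fun t => ξ (t.hom x)) (F.map_id (op c))
    | succ m ih =>
      intro x
      rw [pow_succ]
      refine (congrArg ξ (map_op_comp_apply F φ (φ ^ m : End c) x)).trans ?_
      exact (LinearMap.congr_fun hφ _).trans (ih x)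
  have hξb : ∀ x, ξ ((F.map b.op).hom x) = ξ x := fun x => by
    rw [← hpow n, ← map_op_comp_apply, hφb, hpow]
  obtain ⟨c₁, i, e, hie, hei⟩ := IsIdempotentComplete.idempotents_split c b hb
  have hsep : IsSeparating F (ξ ∘ₗ (F.map e.op).hom) := by
    intro A x hx
    refine hξ A x fun ψ => ?_
    rw [← hξb, ← map_op_comp_apply, ← hei, Category.assoc, map_op_comp_apply]
    exact hx (i ≫ ψ)
  have hb1 : b = 𝟙 c := by
    by_contra hne
    exact hmin _ ⟨c₁, _, hsep, rfl⟩
      (length_end_lt_of_retract (homFinite c c) i e hie (hei ▸ hne))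
  obtain ⟨m, rfl⟩ := Nat.exists_eq_succ_of_ne_zero hn.ne'
  refine ⟨(φ ^ m : End c) ≫ d, ?_⟩
  rw [← hb1, ← hd, Nat.succ_eq_add_one, pow_succ]
  exact (Category.assoc _ _ _).symm

variable [IsArtinianRing k]

lemma isSeparating_formOfCoyonedaHom (hE : IsInjectiveEnvelopeOfResidueField k E)
    {F : Cᵒᵖ ⥤ ModuleCat.{v} k} {c : C}
    (t : (linearCoyoneda k C).obj (op c) ⟶ (dualizeContra k E C).obj (op F))
    (ht : ∀ A, Function.Surjective (t.app A).hom) : IsSeparating F (formOfCoyonedaHom t) := by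
  intro A x hx
  by_contra hne
  obtain ⟨η, hη⟩ := hE.exists_linearMap_ne_zero hne
  obtain ⟨ψ, hψ⟩ := ht A ((dualizeContraEquiv F A).symm η)
  refine hη ?_
  rw [← (dualizeContraEquiv F A).apply_symm_apply η, ← hψ]
  exact (LinearMap.congr_fun (dualizeContraEquiv_app t ψ) x).trans (hx ψ)

lemma IsDualisingVariety.exists_isSeparating (hE : IsInjectiveEnvelopeOfResidueField k E)
    (hdv : IsDualisingVariety k E C) {F : Cᵒᵖ ⥤ ModuleCat.{v} k} (hF : IsFPContra k C F) :
    ∃ (c : C) (ξ : F.obj (op c) →ₗ[k] E), IsSeparating F ξ := by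
  obtain ⟨h, -⟩ := hdv
  obtain ⟨X, Y, p, ⟨e⟩⟩ := h ⟨F, hF⟩
  refine ⟨X, _, isSeparating_formOfCoyonedaHom hE
    (cokernel.π ((linearCoyoneda k C).map p.op) ≫ e.inv) fun A => ?_⟩
  exact (ModuleCat.epi_iff_surjective _).1 inferInstance

lemma IsDualisingVariety.isFPContra_dualCoyoneda (hE : IsInjectiveEnvelopeOfResidueField k E)
    (hdv : IsDualisingVariety k E C) (c : C) : IsFPContra k C (dualCoyoneda k E c) := by
  have hdv' := hdv
  obtain ⟨h, heq⟩ := hdv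
  let Φ := ObjectProperty.lift (IsFPCov k C)
      ((ObjectProperty.ι (IsFPContra k C)).op ⋙ dualizeContra k E C) (fun F => h F.unop)
  let P : ObjectProperty.FullSubcategory (IsFPCov k C) := ⟨_, isFPCov_linearCoyoneda_obj c⟩
  let F := (Φ.objPreimage P).unop
  let e : (linearCoyoneda k C).obj (op c) ≅ (dualizeContra k E C).obj (op F.obj) :=
    (ObjectProperty.ι _).mapIso (Φ.objObjPreimageIso P).symm
  have hF := F.property.isLinearPresheaf
  let ξ := formOfCoyonedaHom e.hom
  have hsep : IsSeparating F.obj ξ := isSeparating_formOfCoyonedaHom hE e.hom fun A =>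
    (ModuleCat.epi_iff_surjective _).1 inferInstance
  have hiso : ∀ A, IsIso ((toDualCoyoneda hF ξ).app A) := by
    intro A
    refine (ConcreteCategory.isIso_iff_bijective _).2 ⟨?_, fun y => ?_⟩
    · refine (injective_iff_map_eq_zero ((toDualCoyoneda hF ξ).app A).hom).2 fun x hx => ?_
      refine hsep A.unop x fun ψ => ?_
      have h1 := toDualCoyoneda_app (A := A.unop) hF ξ x ψ
      rw [← h1]
      refine (congrArg (fun t => dualCoyonedaEquiv c A.unop t ψ) hx).trans ?_
      exact congrArg (fun t : (c ⟶ A.unop) →ₗ[k] E => t ψ) (map_zero (dualCoyonedaEquiv c A.unop))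
    · let e' : (c ⟶ A.unop) ≃ₗ[k] (F.obj.obj A →ₗ[k] E) :=
        (e.app A.unop).toLinearEquiv ≪≫ₗ dualizeContraEquiv F.obj A.unop
      obtain ⟨z, hz⟩ := hdv'.exists_eval_eq F.property (x := A.unop)
        (dualCoyonedaEquiv c A.unop y ∘ₗ e'.symm.toLinearMap)
      refine ⟨z, (dualCoyonedaEquiv c A.unop).injective (LinearMap.ext fun ψ => ?_)⟩
      have h1 := hz (e' ψ)
      rw [LinearMap.comp_apply, LinearEquiv.coe_coe, e'.symm_apply_apply] at h1
      refine Eq.trans ?_ h1.symm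
      exact (congrArg (fun t : F.obj.obj A →ₗ[k] E => t z) (dualizeContraEquiv_app e.hom ψ)).symm
  have := NatIso.isIso_of_isIso_app (toDualCoyoneda hF ξ)
  exact F.property.of_iso (asIso (toDualCoyoneda hF ξ)).symm

end Separating

section Envelope

variable {k : Type v} [CommRing k] {C : Type u} [Category.{v} C] [Preadditive C] [Linear k C]
variable {E : Type v} [AddCommGroup E] [Module k E]

lemma IsSeparating.mono_homMk {F : ObjectProperty.FullSubcategory (IsFPContra k C)} {c : C}
    {ξ : F.obj.obj (op c) →ₗ[k] E} (hξ : IsSeparating F.obj ξ)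
    (hc : IsFPContra k C (dualCoyoneda k E c)) :
    Mono (ObjectProperty.homMk (toDualCoyoneda F.property.isLinearPresheaf ξ) :
      F ⟶ ⟨dualCoyoneda k E c, hc⟩) := by
  refine mono_fp_of_injective _ fun A => (injective_iff_map_eq_zero _).2 fun x hx => ?_
  refine hξ A x fun ψ => ?_
  rw [← toDualCoyoneda_app F.property.isLinearPresheaf]
  refine (congrArg (fun t => dualCoyonedaEquiv c A t ψ) hx).trans ?_
  exact LinearMap.congr_fun (map_zero (dualCoyonedaEquiv c A)) ψ

/-- Endomorphisms of `D Hom(c, -)` come from endomorphisms of `c`. -/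
lemma IsDualisingVariety.exists_dualCoyonedaEquiv_app_eq (hdv : IsDualisingVariety k E C) {c : C}
    (t : dualCoyoneda k E c ⟶ dualCoyoneda k E c) :
    ∃ φ : c ⟶ c, ∀ (A : C) (y : (dualCoyoneda k E c).obj (op A)) (ψ : c ⟶ A),
      dualCoyonedaEquiv c A ((t.app (op A)).hom y) ψ = dualCoyonedaEquiv c A y (φ ≫ ψ) := by
  obtain ⟨φ, hφ⟩ := hdv.exists_eval_eq (isFPContra_linearYoneda_obj c) (x := c)
    (formOfHom t ∘ₗ (dualCoyonedaEquiv c c).symm.toLinearMap)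
  refine ⟨φ, fun A y ψ => ?_⟩
  have h := hφ (dualCoyonedaEquiv c c (((dualCoyoneda k E c).map ψ.op).hom y))
  refine (dualCoyonedaEquiv_app t y ψ).trans (Eq.trans ?_ (h.trans (dualCoyonedaEquiv_map ψ y φ)))
  exact (congrArg (formOfHom t) ((dualCoyonedaEquiv c c).symm_apply_apply _)).symm

/-- If `ξ` is minimal, the morphism to `D Hom(c, -)` attached to `ξ` is essential. -/
lemma IsDualisingVariety.mono_of_mono_toDualCoyoneda_comp (hdv : IsDualisingVariety k E C)
    (hE : Module.Injective k E) {F G : ObjectProperty.FullSubcategory (IsFPContra k C)} {c : C}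
    {ξ : F.obj.obj (op c) →ₗ[k] E}
    (hmin : ∀ φ : End c, ξ ∘ₗ (F.obj.map (Quiver.Hom.op φ)).hom = ξ → ∃ d, φ ≫ d = 𝟙 c)
    (hc : IsFPContra k C (dualCoyoneda k E c))
    (g : (⟨dualCoyoneda k E c, hc⟩ : ObjectProperty.FullSubcategory (IsFPContra k C)) ⟶ G)
    (hg : Mono ((ObjectProperty.homMk (toDualCoyoneda F.property.isLinearPresheaf ξ) :
      F ⟶ ⟨dualCoyoneda k E c, hc⟩) ≫ g)) : Mono g := by
  have hF := F.property.isLinearPresheaf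
  obtain ⟨h, hh⟩ := (injective_dualCoyoneda hE hc).factors
    (ObjectProperty.homMk (toDualCoyoneda hF ξ) : F ⟶ ⟨dualCoyoneda k E c, hc⟩)
    ((ObjectProperty.homMk (toDualCoyoneda hF ξ) : F ⟶ ⟨dualCoyoneda k E c, hc⟩) ≫ g)
  obtain ⟨φ, hφ⟩ := hdv.exists_dualCoyonedaEquiv_app_eq (g ≫ h).hom
  obtain ⟨d, hd⟩ := hmin φ <| LinearMap.ext fun x => by
    have h1 := hφ c (((toDualCoyoneda hF ξ).app (op c)).hom x) (𝟙 c)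
    have h2 := congrArg (fun t => dualCoyonedaEquiv c c ((t.hom.app (op c)).hom x) (𝟙 c)) hh
    rw [toDualCoyoneda_app, Category.comp_id] at h1
    refine h1.symm.trans (h2.trans ?_)
    exact congrArg (fun t => ξ (t.hom x)) (F.obj.map_id (op c))
  refine mono_fp_of_injective g fun A => (injective_iff_map_eq_zero _).2 fun y hy => ?_
  refine (dualCoyonedaEquiv c A).injective (LinearMap.ext fun ψ => ?_)
  have h1 := hφ A y (d ≫ ψ)
  rw [reassoc_of% hd] at h1
  rw [← h1]
  have h2 : ((g ≫ h).hom.app (op A)).hom y = 0 :=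
    (congrArg (h.hom.app (op A)).hom hy).trans (map_zero _)
  rw [h2, map_zero]
  rfl

/-- If `ξ` is separating and minimal, then `c` lies in `add c'` for each object `c'` which
right determines `α`. -/
lemma IsDualisingVariety.memAdd_of_rightDetermined [IsArtinianRing k] [HasFiniteBiproducts C]
    (hdv : IsDualisingVariety k E C) (hE : IsInjectiveEnvelopeOfResidueField k E) {X Y : C}
    {α : X ⟶ Y} {c c' : C} {ξ : (cokerYoneda k α).obj (op c) →ₗ[k] E}
    (hξ : IsSeparating (cokerYoneda k α) ξ)
    (hmin : ∀ φ : End c, ξ ∘ₗ ((cokerYoneda k α).map (Quiver.Hom.op φ)).hom = ξ →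
      ∃ d, φ ≫ d = 𝟙 c)
    (h : RightDetermined α c') : MemAdd c c' := by
  have hM := isLinearPresheaf_cokerYoneda (k := k) α
  let L : (c ⟶ c) →ₗ[k] ((cokerYoneda k α).obj (op c) →ₗ[k] E) :=
    { toFun := fun f => ξ ∘ₗ ((cokerYoneda k α).map f.op).hom
      map_add' := fun f g => LinearMap.ext fun x =>
        (congrArg ξ (hM.map_add f g x)).trans (map_add ξ _ _)
      map_smul' := fun r f => LinearMap.ext fun x =>
        (congrArg ξ (hM.map_smul r f x)).trans (map_smul ξ _ _) }
  have hmem : ξ ∈ (throughSpan k c' c c).map L := by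
    by_contra hne
    obtain ⟨f, hf⟩ := hE.exists_linearMap_ne_zero
      (mt (Submodule.Quotient.mk_eq_zero ((throughSpan k c' c c).map L)).1 hne)
    obtain ⟨z, hz⟩ := hdv.exists_eval_eq ⟨X, Y, α, ⟨Iso.refl _⟩⟩
      (f ∘ₗ ((throughSpan k c' c c).map L).mkQ)
    have hz0 : z = 0 := by
      refine (rightDetermined_iff k α c').1 h c z fun r => hξ c' _ fun s => ?_
      rw [← map_op_comp_apply]
      refine (hz (L (s ≫ r))).symm.trans ?_
      have h0 : ((throughSpan k c' c c).map L).mkQ (L (s ≫ r)) = 0 :=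
        (Submodule.Quotient.mk_eq_zero _).2
          (Submodule.mem_map_of_mem (comp_mem_throughSpan c' c c s r))
      rw [LinearMap.comp_apply, h0, map_zero]
    refine hf ((hz ξ).trans ?_)
    rw [hz0, map_zero]
  obtain ⟨t, ht, htξ⟩ := hmem
  obtain ⟨d, hd⟩ := hmin t htξ
  rw [memAdd_iff_id_mem_throughSpan (k := k), ← hd]
  simpa using comp_comp_mem_throughSpan ht (𝟙 c) d

end Envelope

/-- Proposition `pr:min`.  Let `C` be a dualising `k`-variety and
`α : X ⟶ Y` a morphism of `C`.  Then in `mod C` there is an injective envelope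
`Coker Hom_C(−, α) ⟶ D Hom_C(c, −)` for some object `c`; this `c` right determines `α`,
and for any `c' : C`, `α` is right determined by `c'` iff `add c ⊆ add c'`. -/
theorem stmt_14 {k : Type v} [CommRing k] [IsArtinianRing k]
    (E : Type v) [AddCommGroup E] [Module k E]
    (hE : IsInjectiveEnvelopeOfResidueField k E)
    {C : Type u} [Category.{v} C] [Preadditive C] [Linear k C] [HasFiniteBiproducts C]
    [EssentiallySmall.{v} C] [IsIdempotentComplete C]
    (homFinite : ∀ A B : C, IsFiniteLength k (A ⟶ B))
    (hdv : IsDualisingVariety k E C)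
    {X Y : C} (α : X ⟶ Y) :
    ∃ (c : C)
      (hc : IsFPContra k C ((dualizeCov k E C).obj (op ((linearCoyoneda k C).obj (op c)))))
      (ι : (⟨Limits.cokernel ((linearYoneda k C).map α), X, Y, α, ⟨Iso.refl _⟩⟩ :
              ObjectProperty.FullSubcategory (IsFPContra k C)) ⟶
            ⟨(dualizeCov k E C).obj (op ((linearCoyoneda k C).obj (op c))), hc⟩),
      -- `ι` is an injective envelope: an essential monomorphism into an injective object
      Mono ι ∧
      (∀ ⦃G : ObjectProperty.FullSubcategory (IsFPContra k C)⦄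
        (g : (⟨(dualizeCov k E C).obj (op ((linearCoyoneda k C).obj (op c))), hc⟩ :
            ObjectProperty.FullSubcategory (IsFPContra k C)) ⟶ G), Mono (ι ≫ g) → Mono g) ∧
      Injective (⟨(dualizeCov k E C).obj (op ((linearCoyoneda k C).obj (op c))), hc⟩ :
        ObjectProperty.FullSubcategory (IsFPContra k C)) ∧
      -- `α` is right determined by `c`, and minimally so:
      RightDetermined α c ∧
      (∀ c' : C, RightDetermined α c' ↔ ∀ x : C, MemAdd x c → MemAdd x c') := by
  obtain ⟨c₀, ξ₀, h₀⟩ := hdv.exists_isSeparating hE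
    (⟨X, Y, α, ⟨Iso.refl _⟩⟩ : IsFPContra k C (cokerYoneda k α))
  obtain ⟨c, ξ, hξ, hmin⟩ := h₀.exists_minimal homFinite
  have hc := hdv.isFPContra_dualCoyoneda hE c
  let F : ObjectProperty.FullSubcategory (IsFPContra k C) :=
    ⟨cokerYoneda k α, X, Y, α, ⟨Iso.refl _⟩⟩
  have hdet : RightDetermined α c :=
    (rightDetermined_iff k α c).2 fun A x hx => hξ A x fun φ => by rw [hx φ, map_zero]
  refine ⟨c, hc, ObjectProperty.homMk (toDualCoyoneda F.property.isLinearPresheaf ξ),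
    IsSeparating.mono_homMk (F := F) hξ hc,
    fun G g hg => hdv.mono_of_mono_toDualCoyoneda_comp (F := F) hE.1 hmin hc g hg,
    injective_dualCoyoneda hE.1 hc, hdet, fun c' => ⟨fun h x hx => ?_, fun h => ?_⟩⟩
  · exact hx.trans (hdv.memAdd_of_rightDetermined hE hξ hmin h)
  · exact hdet.of_memAdd (h c (memAdd_self c))
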